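/- arXiv:1611.08549 — 2 statements merged into one kernel-verified Lean document; each statement's English description precedes it below -/
import Mathlib

section
/- For G(n,p), the expectation of ∑_{i≠j} |C_i|^2 |C_j|^2 (sum over ordered pairs of distinct components) is at most S_n(p)^2, where S_n(p) = E[∑_i |C_i|^2]. -/
open scoped Classical BigOperators
noncomputable section

/-- Number of vertices in the connected component of `v` in `G`. -/
def compSize {V : Type*} (G : SimpleGraph V) (v : V) : ℕ :=
  Nat.card {w | G.Reachable v w}

/-- `∑_i |C_i|^k`, the sum of `k`-th powers of the component sizes of `G`. -/
def sumPow {V : Type*} [Fintype V] (G : SimpleGraph V) (k : ℕ) : ℝ :=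
  ∑ c : G.ConnectedComponent, (Nat.card c.supp : ℝ) ^ k

/-- Expectation, under bond percolation with parameter `p` on the finite graph `G`,
of a functional `f` of the resulting random subgraph. -/
def percExpect {V : Type*} [Fintype V] (G : SimpleGraph V) (p : ℝ)
    (f : SimpleGraph V → ℝ) : ℝ :=
  ∑ H ∈ Finset.univ.filter (fun H : SimpleGraph V => H ≤ G),
    p ^ (Nat.card H.edgeSet) * (1 - p) ^ (Nat.card G.edgeSet - Nat.card H.edgeSet) * f H

/-- `S_n(p) = E[∑_i |C_i|^2]` for the Erdős–Rényi random graph `G(n,p)`. -/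
def S (n : ℕ) (p : ℝ) : ℝ := percExpect (⊤ : SimpleGraph (Fin n)) p (fun H => sumPow H 2)

/-- `∑_{i ≠ j} |C_i|^2 |C_j|^2`, summed over ordered pairs of distinct components. -/
def sumOffDiag {V : Type*} [Fintype V] (H : SimpleGraph V) : ℝ :=
  ∑ c : H.ConnectedComponent, ∑ c' : H.ConnectedComponent,
    (if c ≠ c' then (Nat.card c.supp : ℝ) ^ 2 * (Nat.card c'.supp : ℝ) ^ 2 else 0)

/-- The graph with the edges of `H` that meet `A` and the edges of `K` that do not. -/
def mixGraph {V : Type*} (A : Set V) (H K : SimpleGraph V) : SimpleGraph V where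
  Adj a b := if a ∈ A ∨ b ∈ A then H.Adj a b else K.Adj a b
  symm := ⟨fun a b h => by
    simp only [or_comm (a := b ∈ A), H.adj_comm b a, K.adj_comm b a]
    exact h⟩
  loopless := ⟨fun a => by simp⟩

theorem mixGraph_adj {V : Type*} {A : Set V} {H K : SimpleGraph V} {a b : V} :
    (mixGraph A H K).Adj a b ↔ if a ∈ A ∨ b ∈ A then H.Adj a b else K.Adj a b := Iff.rfl

theorem mixGraph_mixGraph {V : Type*} (A : Set V) (H K : SimpleGraph V) :
    mixGraph A (mixGraph A H K) (mixGraph A K H) = H := by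
  ext a b
  simp only [mixGraph_adj]
  split_ifs <;> rfl

theorem edgeSet_mixGraph {V : Type*} (A : Set V) (H K : SimpleGraph V) :
    (mixGraph A H K).edgeSet =
      (H.edgeSet ∩ {e | ∃ a ∈ A, a ∈ e}) ∪ (K.edgeSet \ {e | ∃ a ∈ A, a ∈ e}) := by
  ext e
  induction e using Sym2.ind with
  | _ a b =>
    have h : (∃ c ∈ A, c ∈ s(a, b)) ↔ a ∈ A ∨ b ∈ A := by
      simp only [Sym2.mem_iff]
      constructor
      · rintro ⟨c, hc, rfl | rfl⟩ <;> simp [hc]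
      · rintro (h | h)
        · exact ⟨a, h, Or.inl rfl⟩
        · exact ⟨b, h, Or.inr rfl⟩
    simp only [SimpleGraph.mem_edgeSet, mixGraph_adj, Set.mem_union, Set.mem_inter_iff,
      Set.mem_sdiff, Set.mem_ofPred_eq, h]
    split_ifs with h' <;> simp [h']

theorem card_edgeSet_mixGraph_add {V : Type*} [Finite V] (A : Set V) (H K : SimpleGraph V) :
    Nat.card (mixGraph A H K).edgeSet + Nat.card (mixGraph A K H).edgeSet =
      Nat.card H.edgeSet + Nat.card K.edgeSet := by
  simp only [Nat.card_coe_set_eq, edgeSet_mixGraph]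
  have hd (s t u : Set (Sym2 V)) : Disjoint (s ∩ u) (t \ u) :=
    Set.disjoint_sdiff_right.mono_left Set.inter_subset_right
  rw [Set.ncard_union_eq (hd _ _ _), Set.ncard_union_eq (hd _ _ _),
    ← Set.ncard_inter_add_ncard_sdiff_eq_ncard H.edgeSet {e | ∃ a ∈ A, a ∈ e},
    ← Set.ncard_inter_add_ncard_sdiff_eq_ncard K.edgeSet {e | ∃ a ∈ A, a ∈ e}]
  omega

/-- The vertex set of the component of `v`. -/
def cluster {V : Type*} (H : SimpleGraph V) (v : V) : Set V := {w | H.Reachable v w}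

theorem cluster_mixGraph_cluster {V : Type*} (H K : SimpleGraph V) (v : V) :
    cluster (mixGraph (cluster H v) H K) v = cluster H v := by
  ext w
  constructor
  · intro h
    replace h := (SimpleGraph.reachable_iff_reflTransGen _ _).1 h
    induction h with
    | refl => exact SimpleGraph.Reachable.refl v
    | tail _ hab ih =>
      rw [mixGraph_adj, if_pos (Or.inl ih)] at hab
      exact SimpleGraph.Reachable.trans ih hab.reachable
  · intro h
    replace h := (SimpleGraph.reachable_iff_reflTransGen _ _).1 h
    induction h with
    | refl => exact SimpleGraph.Reachable.refl v
    | @tail a b ha hab ih =>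
      have ha' : a ∈ cluster H v := (SimpleGraph.reachable_iff_reflTransGen _ _).2 ha
      have hK : (mixGraph (cluster H v) H K).Adj a b := by
        rwa [mixGraph_adj, if_pos (Or.inl ha')]
      exact SimpleGraph.Reachable.trans ih hK.reachable

theorem reachable_mixGraph_of_not_reachable {V : Type*} {H K : SimpleGraph V} {v y z : V}
    (hvy : ¬ H.Reachable v y) (hyz : H.Reachable y z) :
    (mixGraph (cluster H v) K H).Reachable y z := by
  have key : ∀ w, H.Reachable y w → w ∉ cluster H v := fun w hw hv => hvy (hv.trans hw.symm)
  replace hyz := (SimpleGraph.reachable_iff_reflTransGen _ _).1 hyz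
  induction hyz with
  | refl => exact SimpleGraph.Reachable.refl y
  | @tail a b ha hab ih =>
    have ha' : H.Reachable y a := (SimpleGraph.reachable_iff_reflTransGen _ _).2 ha
    refine ih.trans (SimpleGraph.Adj.reachable ?_)
    rw [mixGraph_adj, if_neg]
    · exact hab
    · rintro (h | h)
      · exact key a ha' h
      · exact key b (ha'.trans hab.reachable) h

/-- Swap, between two graphs, the edges that avoid the cluster of `v` in the first one. -/
def swapOffCluster {V : Type*} (v : V) (q : SimpleGraph V × SimpleGraph V) :
    SimpleGraph V × SimpleGraph V :=
  (mixGraph (cluster q.1 v) q.1 q.2, mixGraph (cluster q.1 v) q.2 q.1)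

theorem swapOffCluster_involutive {V : Type*} (v : V) :
    Function.Involutive (swapOffCluster v) := by
  rintro ⟨H, K⟩
  simp only [swapOffCluster, cluster_mixGraph_cluster, mixGraph_mixGraph]

/-- The probability of `H` under the uniform percolation measure on the complete graph. -/
def percWeight {V : Type*} (p : ℝ) (H : SimpleGraph V) : ℝ :=
  p ^ Nat.card H.edgeSet *
    (1 - p) ^ (Nat.card (⊤ : SimpleGraph V).edgeSet - Nat.card H.edgeSet)

theorem percExpect_top {V : Type*} [Fintype V] (p : ℝ) (f : SimpleGraph V → ℝ) :
    percExpect ⊤ p f = ∑ H : SimpleGraph V, percWeight p H * f H := by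
  simp [percExpect, percWeight]

theorem percWeight_nonneg {V : Type*} {p : ℝ} (hp0 : 0 ≤ p) (hp1 : p ≤ 1) (H : SimpleGraph V) :
    0 ≤ percWeight p H :=
  mul_nonneg (pow_nonneg hp0 _) (pow_nonneg (sub_nonneg.2 hp1) _)

theorem sum_percWeight {V : Type*} [Fintype V] (p : ℝ) :
    ∑ H : SimpleGraph V, percWeight p H = 1 := by
  have h := Finset.sum_pow_mul_eq_add_pow p (1 - p) (⊤ : SimpleGraph V).edgeFinset
  rw [add_sub_cancel, one_pow] at h
  rw [← h]
  refine Finset.sum_bij' (fun H _ => H.edgeFinset)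
    (fun t _ => SimpleGraph.fromEdgeSet (t : Set (Sym2 V))) ?_ ?_ ?_ ?_ ?_
  · intro H _
    exact Finset.mem_powerset.2 (SimpleGraph.edgeFinset_mono le_top)
  · simp
  · intro H _
    simp
  · intro t ht
    ext e
    have := Finset.mem_powerset.1 ht
    simp only [SimpleGraph.mem_edgeFinset, SimpleGraph.edgeSet_fromEdgeSet, Set.mem_sdiff,
      Finset.mem_coe]
    refine ⟨fun h => h.1, fun h => ⟨h, ?_⟩⟩
    have h2 := this h
    simpa using h2
  · intro H _
    simp only [percWeight, Nat.card_eq_fintype_card, SimpleGraph.edgeFinset_card]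

theorem percWeight_mul {V : Type*} [Finite V] (p : ℝ) (H K : SimpleGraph V) :
    percWeight p H * percWeight p K =
      p ^ (Nat.card H.edgeSet + Nat.card K.edgeSet) *
        (1 - p) ^ (2 * Nat.card (⊤ : SimpleGraph V).edgeSet -
          (Nat.card H.edgeSet + Nat.card K.edgeSet)) := by
  have hle (H : SimpleGraph V) :
      Nat.card H.edgeSet ≤ Nat.card (⊤ : SimpleGraph V).edgeSet :=
    Nat.card_mono (Set.toFinite _) (SimpleGraph.edgeSet_mono le_top)
  have h : 2 * Nat.card (⊤ : SimpleGraph V).edgeSet -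
      (Nat.card H.edgeSet + Nat.card K.edgeSet) =
      (Nat.card (⊤ : SimpleGraph V).edgeSet - Nat.card H.edgeSet) +
      (Nat.card (⊤ : SimpleGraph V).edgeSet - Nat.card K.edgeSet) := by
    have := hle H
    have := hle K
    omega
  rw [h, pow_add, pow_add, percWeight, percWeight]
  ring

theorem percWeight_swapOffCluster {V : Type*} [Finite V] (p : ℝ) (v : V)
    (q : SimpleGraph V × SimpleGraph V) :
    percWeight p (swapOffCluster v q).1 * percWeight p (swapOffCluster v q).2 =
      percWeight p q.1 * percWeight p q.2 := by
  simp only [percWeight_mul, swapOffCluster, card_edgeSet_mixGraph_add]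

/-- The probability that `x, x'` are connected, `y, y'` are connected and the two pairs lie in
different components is at most the product of the two connection probabilities. -/
theorem prob_disjoint_connections_le {V : Type*} [Fintype V] {p : ℝ} (hp0 : 0 ≤ p) (hp1 : p ≤ 1)
    (x x' y y' : V) :
    ∑ H : SimpleGraph V, percWeight p H *
        (if H.Reachable x x' ∧ H.Reachable y y' ∧ ¬ H.Reachable x y then 1 else 0) ≤
      (∑ H : SimpleGraph V, percWeight p H * (if H.Reachable x x' then 1 else 0)) *
        ∑ H : SimpleGraph V, percWeight p H * (if H.Reachable y y' then 1 else 0) := by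
  have hone (a : ℝ) : a = a * ∑ H : SimpleGraph V, percWeight p H := by
    rw [sum_percWeight, mul_one]
  rw [hone (∑ H : SimpleGraph V, _), Finset.sum_mul_sum,
    Finset.sum_mul_sum, ← Fintype.sum_prod_type', ← Fintype.sum_prod_type']
  conv_rhs => rw [← (swapOffCluster_involutive x).bijective.sum_comp]
  refine Finset.sum_le_sum fun q _ => ?_
  have hw := percWeight_swapOffCluster p x q
  have hq : 0 ≤ percWeight p q.1 * percWeight p q.2 :=
    mul_nonneg (percWeight_nonneg hp0 hp1 _) (percWeight_nonneg hp0 hp1 _)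
  rw [mul_right_comm, mul_mul_mul_comm, hw]
  refine mul_le_mul_of_nonneg_left ?_ hq
  by_cases h : q.1.Reachable x x' ∧ q.1.Reachable y y' ∧ ¬ q.1.Reachable x y
  · have h1 : (swapOffCluster x q).1.Reachable x x' := by
      have : x' ∈ cluster (swapOffCluster x q).1 x := by
        rw [swapOffCluster, cluster_mixGraph_cluster]
        exact h.1
      exact this
    have h2 : (swapOffCluster x q).2.Reachable y y' :=
      reachable_mixGraph_of_not_reachable h.2.2 h.2.1
    simp [h, h1, h2]
  · rw [if_neg h]
    split_ifs <;> simp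

theorem sum_card_supp_mul {V : Type*} [Fintype V] (H : SimpleGraph V)
    (f : H.ConnectedComponent → ℝ) :
    ∑ c : H.ConnectedComponent, (Nat.card c.supp : ℝ) * f c =
      ∑ v, f (H.connectedComponentMk v) := by
  rw [← Finset.sum_fiberwise Finset.univ H.connectedComponentMk]
  refine Finset.sum_congr rfl fun c _ => ?_
  rw [Finset.sum_congr rfl (g := fun _ => f c)
    (fun v hv => by rw [(Finset.mem_filter.1 hv).2]), Finset.sum_const, nsmul_eq_mul]
  congr 2
  rw [Nat.card_eq_fintype_card, Fintype.card_subtype]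
  congr 1
  ext v
  simp

theorem card_supp_connectedComponentMk {V : Type*} [Fintype V] (H : SimpleGraph V) (v : V) :
    (Nat.card (H.connectedComponentMk v).supp : ℝ) =
      ∑ w, if H.Reachable v w then 1 else 0 := by
  rw [Finset.sum_boole, Nat.card_eq_fintype_card, Fintype.card_subtype]
  congr 2
  ext w
  simp [SimpleGraph.reachable_comm]

theorem sumPow_two {V : Type*} [Fintype V] (H : SimpleGraph V) :
    sumPow H 2 = ∑ x, ∑ x', if H.Reachable x x' then 1 else 0 := by
  simp only [sumPow, sq, sum_card_supp_mul, card_supp_connectedComponentMk]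

theorem sumOffDiag_eq {V : Type*} [Fintype V] (H : SimpleGraph V) :
    sumOffDiag H = ∑ x, ∑ x', ∑ y, ∑ y',
      if H.Reachable x x' ∧ H.Reachable y y' ∧ ¬ H.Reachable x y then 1 else 0 := by
  have h1 : sumOffDiag H = ∑ c : H.ConnectedComponent, (Nat.card c.supp : ℝ) *
      ((Nat.card c.supp : ℝ) * ∑ c' : H.ConnectedComponent, (Nat.card c'.supp : ℝ) *
        (if c ≠ c' then (Nat.card c'.supp : ℝ) else 0)) := by
    simp only [sumOffDiag, Finset.mul_sum]
    refine Finset.sum_congr rfl fun c _ => Finset.sum_congr rfl fun c' _ => ?_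
    split_ifs <;> ring
  rw [h1]
  simp only [sum_card_supp_mul, card_supp_connectedComponentMk, Finset.sum_mul]
  refine Finset.sum_congr rfl fun x _ => Finset.sum_congr rfl fun x' _ => ?_
  rw [Finset.mul_sum]
  refine Finset.sum_congr rfl fun y _ => ?_
  by_cases hxy : H.Reachable x y
  · simp [hxy]
  · by_cases hx : H.Reachable x x' <;> simp [hxy, hx]

theorem percExpect_sumOffDiag_le {V : Type*} [Fintype V] {p : ℝ} (hp0 : 0 ≤ p) (hp1 : p ≤ 1) :
    percExpect (⊤ : SimpleGraph V) p sumOffDiag ≤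
      (percExpect (⊤ : SimpleGraph V) p fun H => sumPow H 2) ^ 2 := by
  have hS : percExpect (⊤ : SimpleGraph V) p (fun H => sumPow H 2) = ∑ x, ∑ x', ∑ H : SimpleGraph V,
      percWeight p H * (if H.Reachable x x' then 1 else 0) := by
    simp only [percExpect_top, sumPow_two, Finset.mul_sum]
    rw [Finset.sum_comm]
    exact Finset.sum_congr rfl fun x _ => Finset.sum_comm
  have hE : percExpect (⊤ : SimpleGraph V) p sumOffDiag =
      ∑ x, ∑ x', ∑ y, ∑ y', ∑ H : SimpleGraph V, percWeight p H *
        (if H.Reachable x x' ∧ H.Reachable y y' ∧ ¬ H.Reachable x y then 1 else 0) := by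
    simp only [percExpect_top, sumOffDiag_eq, Finset.mul_sum]
    rw [Finset.sum_comm]
    refine Finset.sum_congr rfl fun x _ => ?_
    rw [Finset.sum_comm]
    refine Finset.sum_congr rfl fun x' _ => ?_
    rw [Finset.sum_comm]
    exact Finset.sum_congr rfl fun y _ => Finset.sum_comm
  rw [hE, hS, sq]
  simp only [Finset.sum_mul]
  refine Finset.sum_le_sum fun x _ => Finset.sum_le_sum fun x' _ => ?_
  rw [← Finset.sum_mul, Finset.mul_sum]
  refine Finset.sum_le_sum fun y _ => ?_
  rw [Finset.mul_sum]
  exact Finset.sum_le_sum fun y' _ => prob_disjoint_connections_le hp0 hp1 x x' y y'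

/-- For `G(n,p)`: `E[∑_{i≠j} |C_i|^2 |C_j|^2] ≤ S_n(p)^2`. -/
theorem offDiag_le_S_sq (n : ℕ) (p : ℝ) (hp0 : 0 ≤ p) (hp1 : p ≤ 1) :
    percExpect (⊤ : SimpleGraph (Fin n)) p sumOffDiag ≤ (S n p) ^ 2 := by
  exact percExpect_sumOffDiag_le hp0 hp1
end
end

section
/- For any finite transitive graph G, percolation probability p, integer k ≥ 1, and vertex v, the Aizenman–Newman tree-graph inequality holds: E_p[|C(v)|^k] ≤ (2k−3)!! · (E_p|C(v)|)^{2k−1}. -/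
open scoped Classical BigOperators
noncomputable section

namespace Percolation

open Finset Relation

section Product

variable {α : Type*}

/-- Expectation of `f` of a random subset of `E` containing each element independently with
probability `p`. -/
def subsetExpect (p : ℝ) (E : Finset α) (f : Finset α → ℝ) : ℝ :=
  ∑ S ∈ E.powerset, p ^ #S * (1 - p) ^ (#E - #S) * f S

/-- Probability that a random subset of `E`, containing each element independently with
probability `p`, satisfies `P`. -/
def subsetProb (p : ℝ) (E : Finset α) (P : Finset α → Prop) : ℝ :=
  subsetExpect p E fun S => if P S then 1 else 0

/-- `P` and `Q` have disjoint witnesses inside the set. -/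
def DisjointOccur (P Q : Finset α → Prop) (S : Finset α) : Prop :=
  ∃ I J, Disjoint I J ∧ I ⊆ S ∧ J ⊆ S ∧ P I ∧ Q J

lemma DisjointOccur.mono {P P' Q Q' : Finset α → Prop} (hP : ∀ S, P S → P' S)
    (hQ : ∀ S, Q S → Q' S) {S : Finset α} : DisjointOccur P Q S → DisjointOccur P' Q' S :=
  fun ⟨I, J, h, hI, hJ, hPI, hQJ⟩ => ⟨I, J, h, hI, hJ, hP I hPI, hQ J hQJ⟩

lemma DisjointOccur.monotone (P Q : Finset α → Prop) : Monotone (DisjointOccur P Q) :=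
  fun _ _ hST ⟨I, J, h, hI, hJ, hPQ⟩ => ⟨I, J, h, hI.trans hST, hJ.trans hST, hPQ⟩

lemma DisjointOccur.of_insert {P Q : Finset α → Prop} (hQ : Monotone Q)
    {e : α} {S : Finset α} (h : DisjointOccur P Q (insert e S)) :
    DisjointOccur (fun T => P (insert e T)) Q S ∨
      DisjointOccur P (fun T => Q (insert e T)) S := by
  obtain ⟨I, J, hd, hI, hJ, hPI, hQJ⟩ := h
  by_cases he : e ∈ I
  · have heJ : e ∉ J := disjoint_left.mp hd he
    refine Or.inl ⟨I.erase e, J, hd.mono_left (erase_subset _ _), ?_, ?_, ?_, hQJ⟩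
    · exact subset_insert_iff.mp hI
    · exact (subset_insert_iff_of_notMem heJ).mp hJ
    · simpa only [insert_erase he] using hPI
  · refine Or.inr ⟨I, J.erase e, hd.mono_right (erase_subset _ _), ?_, ?_, hPI, ?_⟩
    · exact (subset_insert_iff_of_notMem he).mp hI
    · exact subset_insert_iff.mp hJ
    · exact hQ (insert_erase_subset e J) hQJ

lemma subsetExpect_insert (p : ℝ) {e : α} {E : Finset α} (he : e ∉ E) (f : Finset α → ℝ) :
    subsetExpect p (insert e E) f =
      (1 - p) * subsetExpect p E f + p * subsetExpect p E (fun S => f (insert e S)) := by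
  unfold subsetExpect
  rw [sum_powerset_insert he, mul_sum, mul_sum]
  congr 1
  · refine sum_congr rfl fun S hS => ?_
    have := card_le_card (mem_powerset.mp hS)
    rw [card_insert_of_notMem he, Nat.sub_add_comm this, pow_succ]
    ring
  · refine sum_congr rfl fun S hS => ?_
    have heS : e ∉ S := fun h => he (mem_powerset.mp hS h)
    rw [card_insert_of_notMem he, card_insert_of_notMem heS, Nat.add_sub_add_right, pow_succ]
    ring

lemma subsetExpect_mono {p : ℝ} (hp0 : 0 ≤ p) (hp1 : p ≤ 1) (E : Finset α)
    {f g : Finset α → ℝ} (h : ∀ S, f S ≤ g S) : subsetExpect p E f ≤ subsetExpect p E g := by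
  have := sub_nonneg.mpr hp1
  exact sum_le_sum fun S _ => mul_le_mul_of_nonneg_left (h S) (by positivity)

lemma subsetExpect_nonneg {p : ℝ} (hp0 : 0 ≤ p) (hp1 : p ≤ 1) (E : Finset α)
    {f : Finset α → ℝ} (h : ∀ S, 0 ≤ f S) : 0 ≤ subsetExpect p E f := by
  have := sub_nonneg.mpr hp1
  exact sum_nonneg fun S _ => mul_nonneg (by positivity) (h S)

lemma subsetExpect_sum {κ : Type*} (p : ℝ) (E : Finset α) (s : Finset κ)
    (f : κ → Finset α → ℝ) :
    subsetExpect p E (fun S => ∑ i ∈ s, f i S) = ∑ i ∈ s, subsetExpect p E (f i) := by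
  simp only [subsetExpect, mul_sum]
  exact sum_comm

lemma subsetExpect_add (p : ℝ) (E : Finset α) (f g : Finset α → ℝ) :
    subsetExpect p E (fun S => f S + g S) = subsetExpect p E f + subsetExpect p E g := by
  simp only [subsetExpect, mul_add, sum_add_distrib]

lemma subsetProb_nonneg {p : ℝ} (hp0 : 0 ≤ p) (hp1 : p ≤ 1) (E : Finset α)
    (P : Finset α → Prop) : 0 ≤ subsetProb p E P :=
  subsetExpect_nonneg hp0 hp1 E fun S => by split_ifs <;> norm_num

lemma subsetProb_mono {p : ℝ} (hp0 : 0 ≤ p) (hp1 : p ≤ 1) (E : Finset α)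
    {P Q : Finset α → Prop} (h : ∀ S, P S → Q S) : subsetProb p E P ≤ subsetProb p E Q := by
  refine subsetExpect_mono hp0 hp1 E fun S => ?_
  have := h S
  split_ifs <;> simp_all

/-- The van den Berg–Kesten inequality for increasing events. -/
theorem subsetProb_disjointOccur_le {p : ℝ} (hp0 : 0 ≤ p) (hp1 : p ≤ 1) (E : Finset α)
    {P Q : Finset α → Prop} (hP : Monotone P) (hQ : Monotone Q) :
    subsetProb p E (DisjointOccur P Q) ≤ subsetProb p E P * subsetProb p E Q := by
  induction E using Finset.induction_on generalizing P Q with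
  | empty =>
    have key : DisjointOccur P Q ∅ → P ∅ ∧ Q ∅ := by
      rintro ⟨I, J, -, hI, hJ, hPI, hQJ⟩
      exact ⟨hP hI hPI, hQ hJ hQJ⟩
    simp only [subsetProb, subsetExpect, powerset_empty, sum_singleton, card_empty, pow_zero,
      Nat.sub_self, mul_one, one_mul]
    split_ifs <;> simp_all
  | insert e E he ih =>
    set P' : Finset α → Prop := fun S => P (insert e S)
    set Q' : Finset α → Prop := fun S => Q (insert e S)
    have hPP' : ∀ S, P S → P' S := fun S => hP (subset_insert e S)
    have hQQ' : ∀ S, Q S → Q' S := fun S => hQ (subset_insert e S)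
    have hmP' : Monotone P' := fun S T h => hP (insert_subset_insert e h)
    have hmQ' : Monotone Q' := fun S T h => hQ (insert_subset_insert e h)
    have split (R : Finset α → Prop) : subsetProb p (insert e E) R =
        (1 - p) * subsetProb p E R + p * subsetProb p E (fun S => R (insert e S)) :=
      subsetExpect_insert p he _
    have hunion : subsetProb p E (fun S => DisjointOccur P Q (insert e S)) +
        subsetProb p E (DisjointOccur P Q) ≤
        subsetProb p E (DisjointOccur P' Q) + subsetProb p E (DisjointOccur P Q') := by
      simp only [subsetProb, ← subsetExpect_add]
      refine subsetExpect_mono hp0 hp1 E fun S => ?_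
      have h1 : DisjointOccur P Q (insert e S) → DisjointOccur P' Q S ∨ DisjointOccur P Q' S :=
        DisjointOccur.of_insert hQ
      have h2 : DisjointOccur P Q S → DisjointOccur P' Q S :=
        DisjointOccur.mono hPP' fun _ => id
      have h3 : DisjointOccur P Q S → DisjointOccur P Q' S :=
        DisjointOccur.mono (fun _ => id) hQQ'
      by_cases h : DisjointOccur P Q S
      · rw [if_pos h, if_pos (h2 h), if_pos (h3 h)]
        split_ifs <;> norm_num
      · rw [if_neg h]
        split_ifs <;> first | tauto | norm_num
    have hboth : subsetProb p E (fun S => DisjointOccur P Q (insert e S)) ≤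
        subsetProb p E (DisjointOccur P' Q') :=
      subsetProb_mono hp0 hp1 E fun S h => (DisjointOccur.of_insert hQ h).elim
        (DisjointOccur.mono (fun _ => id) hQQ') (DisjointOccur.mono hPP' fun _ => id)
    have h00 := ih hP hQ
    have h10 := ih hmP' hQ
    have h01 := ih hP hmQ'
    have h11 := ih hmP' hmQ'
    have hd : 0 ≤ (subsetProb p E P' - subsetProb p E P) *
        (subsetProb p E Q' - subsetProb p E Q) :=
      mul_nonneg (sub_nonneg.mpr (subsetProb_mono hp0 hp1 E hPP'))
        (sub_nonneg.mpr (subsetProb_mono hp0 hp1 E hQQ'))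
    rw [split, split P, split Q]
    have hq := sub_nonneg.mpr hp1
    rcases le_total p (1 - p) with h | h
    · nlinarith [mul_nonneg (sq_nonneg p) hd, mul_le_mul_of_nonneg_left h00 (sub_nonneg.mpr h),
        mul_le_mul_of_nonneg_left hunion hp0, mul_le_mul_of_nonneg_left h10 hp0,
        mul_le_mul_of_nonneg_left h01 hp0]
    · nlinarith [mul_nonneg (sq_nonneg (1 - p)) hd,
        mul_le_mul_of_nonneg_left (hboth.trans h11) (sub_nonneg.mpr h),
        mul_le_mul_of_nonneg_left hunion hq, mul_le_mul_of_nonneg_left h10 hq,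
        mul_le_mul_of_nonneg_left h01 hq]

end Product

section Connectivity

variable {V : Type*}

/-- `a` and `b` are joined by a path of edges in `F`. -/
def Joined (F : Finset (Sym2 V)) (a b : V) : Prop :=
  ReflTransGen (fun a b => s(a, b) ∈ F) a b

lemma Joined.mono {F F' : Finset (Sym2 V)} (h : F ⊆ F') {a b : V} (hab : Joined F a b) :
    Joined F' a b :=
  ReflTransGen.mono (fun _ _ hF => h hF) _ _ hab

lemma Joined.symm {F : Finset (Sym2 V)} {a b : V} (h : Joined F a b) : Joined F b a := by
  induction h with
  | refl => exact .refl
  | tail _ hbc ih => exact .head (by rwa [Sym2.eq_swap]) ih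

lemma joined_monotone (a b : V) : Monotone fun F : Finset (Sym2 V) => Joined F a b :=
  fun _ _ h hab => hab.mono h

lemma forall_joined_monotone {ι : Type*} (a : V) (x : ι → V) (A : Set ι) :
    Monotone fun F : Finset (Sym2 V) => ∀ i ∈ A, Joined F a (x i) :=
  fun _ _ h hF i hi => (hF i hi).mono h

lemma Joined.of_erase {F : Finset (Sym2 V)} {v u y : V} (h : Joined F v y) :
    Joined (F.erase s(v, u)) v y ∨ Joined (F.erase s(v, u)) u y := by
  induction h with
  | refl => exact .inl .refl
  | @tail b c _ hbc ih =>
    by_cases he : s(b, c) = s(v, u)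
    · rcases Sym2.eq_iff.mp he with ⟨-, rfl⟩ | ⟨-, rfl⟩
      · exact .inr .refl
      · exact .inl .refl
    · have := mem_erase.mpr ⟨he, hbc⟩
      exact ih.imp (fun h => h.tail this) fun h => h.tail this

/-- If `v` is joined to at least two targets, there is a first branching vertex `w`. -/
lemma exists_branching {ι : Type*} [Nontrivial ι] (x : ι → V) (F : Finset (Sym2 V)) (v : V)
    (h : ∀ i, Joined F v (x i)) :
    ∃ (w : V) (A : Set ι), A.Nonempty ∧ Aᶜ.Nonempty ∧
      DisjointOccur (fun F => Joined F v w)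
        (DisjointOccur (fun F => ∀ i ∈ A, Joined F w (x i))
          fun F => ∀ i ∈ Aᶜ, Joined F w (x i)) F := by
  induction F using Finset.strongInduction generalizing v with
  | H F ih =>
    by_cases hu : ∃ u, s(v, u) ∈ F
    · obtain ⟨u, hu⟩ := hu
      set F' := F.erase s(v, u)
      have hlt : F' ⊂ F := erase_ssubset hu
      have hor : ∀ i, Joined F' v (x i) ∨ Joined F' u (x i) := fun i => (h i).of_erase
      by_cases hall : ∀ i, Joined F' v (x i)
      · obtain ⟨w, A, hA, hA', hd⟩ := ih F' hlt v hall
        exact ⟨w, A, hA, hA', DisjointOccur.monotone _ _ hlt.subset hd⟩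
      by_cases hnone : ∀ i, ¬ Joined F' v (x i)
      · obtain ⟨w, A, hA, hA', I, J, hIJ, hI, hJ, hvw, hJ'⟩ :=
          ih F' hlt u fun i => (hor i).resolve_left (hnone i)
        refine ⟨w, A, hA, hA', insert s(v, u) I, J, ?_, ?_, hJ.trans hlt.subset, ?_, hJ'⟩
        · rw [disjoint_insert_left]
          exact ⟨fun hm => notMem_erase _ _ (hJ hm), hIJ⟩
        · exact insert_subset hu (hI.trans hlt.subset)
        · exact .head (mem_insert_self _ _) (hvw.mono (subset_insert _ _))
      push Not at hall hnone
      set J := F'.filter (fun f => ∃ a ∈ f, Joined F' v a)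
      have hJF : J ⊆ F' := filter_subset _ _
      refine ⟨v, {i | Joined F' v (x i)}, hnone, hall, ∅, F, disjoint_empty_left _,
        empty_subset _, subset_rfl, .refl, J, insert s(v, u) (F' \ J), ?_,
        hJF.trans hlt.subset, insert_subset hu (sdiff_subset.trans hlt.subset), ?_, ?_⟩
      · rw [disjoint_insert_right]
        exact ⟨fun hm => notMem_erase _ _ (hJF hm), disjoint_sdiff⟩
      · intro i hi
        have key : ∀ y, Joined F' v y → Joined J v y := by
          intro y hy
          induction hy with
          | refl => exact .refl
          | @tail b c hb hbc ihb =>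
            exact ihb.tail (mem_filter.mpr ⟨hbc, b, Sym2.mem_mk_left b c, hb⟩)
        exact key _ hi
      · intro i hi
        have hui : Joined F' u (x i) := (hor i).resolve_left hi
        have hvu : ¬ Joined F' v u := fun hvu => hi (ReflTransGen.trans hvu hui)
        have key : ∀ y, Joined F' u y → Joined (F' \ J) u y := by
          intro y hy
          induction hy with
          | refl => exact .refl
          | @tail b c hb hbc ihb =>
            refine ihb.tail (mem_sdiff.mpr ⟨hbc, fun hm => ?_⟩)
            obtain ⟨-, a, ha, hva⟩ := mem_filter.mp hm
            rcases Sym2.mem_iff.mp ha with rfl | rfl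
            · exact hvu (ReflTransGen.trans hva (Joined.symm hb))
            · exact hvu (ReflTransGen.trans hva (Joined.symm (ReflTransGen.tail hb hbc)))
        exact .head (mem_insert_self _ _) ((key _ hui).mono (subset_insert _ _))
    · have hx : ∀ i, x i = v := by
        intro i
        rcases ReflTransGen.cases_head (h i) with h | ⟨c, hc, -⟩
        · exact h.symm
        · exact absurd ⟨c, hc⟩ hu
      obtain ⟨i, j, hij⟩ := exists_pair_ne ι
      refine ⟨v, {i}, ⟨i, rfl⟩, ⟨j, fun hji => hij hji.symm⟩, ∅, ∅, disjoint_empty_left _,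
        empty_subset _, empty_subset _, .refl, ∅, ∅, disjoint_empty_left _,
        empty_subset _, empty_subset _, ?_, ?_⟩ <;>
      · intro k _
        rw [hx k]
        exact .refl

end Connectivity

section Moments

variable {V : Type*} [Fintype V]

/-- Number of vertices joined to `v` by edges in `F`. -/
def clusterSize (v : V) (F : Finset (Sym2 V)) : ℝ :=
  ∑ w, if Joined F v w then 1 else 0

/-- The `n`-th moment of the cluster size of `v`. -/
def clusterMoment (p : ℝ) (E : Finset (Sym2 V)) (n : ℕ) (v : V) : ℝ :=
  subsetExpect p E fun F => clusterSize v F ^ n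

lemma clusterMoment_nonneg {p : ℝ} (hp0 : 0 ≤ p) (hp1 : p ≤ 1) (E : Finset (Sym2 V)) (n : ℕ)
    (v : V) : 0 ≤ clusterMoment p E n v := by
  refine subsetExpect_nonneg hp0 hp1 E fun F => pow_nonneg (sum_nonneg fun w _ => ?_) n
  split_ifs <;> norm_num

lemma clusterMoment_one (p : ℝ) (E : Finset (Sym2 V)) (v : V) :
    clusterMoment p E 1 v = ∑ w, subsetProb p E fun F => Joined F v w := by
  simp only [clusterMoment, pow_one, clusterSize, subsetProb, subsetExpect_sum]

lemma clusterMoment_card {ι : Type*} [Fintype ι] [DecidableEq ι] (p : ℝ)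
    (E : Finset (Sym2 V)) (v : V) :
    clusterMoment p E (Fintype.card ι) v =
      ∑ x : ι → V, subsetProb p E fun F => ∀ i, Joined F v (x i) := by
  simp only [clusterMoment, clusterSize, subsetProb, ← subsetExpect_sum]
  congr 1
  ext F
  rw [← card_univ, ← prod_const, Fintype.prod_sum]
  refine sum_congr rfl fun x _ => ?_
  rw [Fintype.prod_boole]
  congr

lemma sum_subsetProb_mul {ι : Type*} [Fintype ι] [DecidableEq ι] (p : ℝ)
    (E : Finset (Sym2 V)) (w : V)
    (A : Finset ι) :
    ∑ x : ι → V, (subsetProb p E fun F => ∀ i ∈ A, Joined F w (x i)) *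
        (subsetProb p E fun F => ∀ i ∉ A, Joined F w (x i)) =
      clusterMoment p E #A w * clusterMoment p E (Fintype.card ι - #A) w := by
  have h1 : #A = Fintype.card {i // i ∈ A} := by simp
  have h2 : Fintype.card ι - #A = Fintype.card {i // i ∉ A} := by
    rw [Fintype.card_subtype_compl, ← h1]
  rw [h2, h1, clusterMoment_card, clusterMoment_card, sum_mul_sum, ← Fintype.sum_prod_type',
    ← Equiv.sum_comp (Equiv.piEquivPiSubtypeProd (· ∈ A) fun _ => V)]
  simp [Equiv.piEquivPiSubtypeProd]

/-- The tree-graph bound for the probability of joining `v` to the points `x i`. -/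
lemma two_mul_subsetProb_joined_le {ι : Type*} [Fintype ι] [DecidableEq ι] [Nontrivial ι]
    {p : ℝ} (hp0 : 0 ≤ p) (hp1 : p ≤ 1) (E : Finset (Sym2 V)) (v : V) (x : ι → V) :
    2 * (subsetProb p E fun F => ∀ i, Joined F v (x i)) ≤
      ∑ A : Finset ι with A.Nonempty ∧ Aᶜ.Nonempty, ∑ w,
        (subsetProb p E fun F => Joined F v w) *
          ((subsetProb p E fun F => ∀ i ∈ A, Joined F w (x i)) *
            (subsetProb p E fun F => ∀ i ∉ A, Joined F w (x i))) := by
  set occ : Finset ι → V → Finset (Sym2 V) → Prop := fun A w =>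
    DisjointOccur (fun F => Joined F v w)
      (DisjointOccur (fun F => ∀ i ∈ A, Joined F w (x i))
        fun F => ∀ i ∉ A, Joined F w (x i)) with hocc
  have hswap : ∀ A w F, occ A w F → occ Aᶜ w F := by
    rintro A w F ⟨I, J, hIJ, hI, hJ, hvw, K, L, hKL, hK, hL, hA, hA'⟩
    exact ⟨I, J, hIJ, hI, hJ, hvw, L, K, hKL.symm, hL, hK,
      fun i hi => hA' i (mem_compl.mp hi), fun i hi => hA i (by simpa using hi)⟩
  have hpoint (F : Finset (Sym2 V)) :
      (2 : ℝ) * (if ∀ i, Joined F v (x i) then 1 else 0) ≤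
        ∑ A : Finset ι with A.Nonempty ∧ Aᶜ.Nonempty, ∑ w, if occ A w F then 1 else 0 := by
    have hnn (A : Finset ι) (w : V) : (0 : ℝ) ≤ if occ A w F then 1 else 0 := by
      split_ifs <;> norm_num
    split_ifs with h
    · obtain ⟨w, A, hA, hA', hd⟩ := exists_branching x F v h
      obtain ⟨B, rfl⟩ : ∃ B : Finset ι, A = B := ⟨A.toFinset, by simp⟩
      have hB : B.Nonempty := by exact_mod_cast hA
      have hB' : Bᶜ.Nonempty := by rw [← coe_compl] at hA'; exact_mod_cast hA'
      have hoB : occ B w F := by simpa [hocc] using hd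
      have hne : B ≠ Bᶜ := by
        intro h
        obtain ⟨i, hi⟩ := hB
        exact mem_compl.mp (h ▸ hi) hi
      have hle (A : Finset ι) (hA : occ A w F) :
          (1 : ℝ) ≤ ∑ w, if occ A w F then 1 else 0 := by
        calc (1 : ℝ) = if occ A w F then 1 else 0 := (if_pos hA).symm
          _ ≤ _ := single_le_sum (fun w _ => hnn A w) (mem_univ w)
      calc (2 : ℝ) * 1 ≤ ∑ A ∈ ({B, Bᶜ} : Finset (Finset ι)),
            ∑ w, if occ A w F then 1 else 0 := by
            rw [sum_pair hne]
            linarith [hle B hoB, hle _ (hswap B w F hoB)]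
        _ ≤ _ := by
            refine sum_le_sum_of_subset_of_nonneg ?_ fun A _ _ => sum_nonneg fun w _ => hnn A w
            intro A hA
            rcases mem_insert.mp hA with rfl | hA
            · simp [hB, hB']
            · rw [mem_singleton.mp hA]
              simp [hB, hB']
    · simpa using sum_nonneg fun A _ => sum_nonneg fun w _ => hnn A w
  calc 2 * (subsetProb p E fun F => ∀ i, Joined F v (x i))
      = subsetExpect p E fun F => (2 : ℝ) * (if ∀ i, Joined F v (x i) then 1 else 0) := by
        simp only [two_mul, subsetExpect_add, subsetProb]
        congr!
    _ ≤ ∑ A : Finset ι with A.Nonempty ∧ Aᶜ.Nonempty, ∑ w, subsetProb p E (occ A w) := by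
        simp only [subsetProb, ← subsetExpect_sum]
        exact subsetExpect_mono hp0 hp1 E hpoint
    _ ≤ _ := by
        refine sum_le_sum fun A _ => sum_le_sum fun w _ => ?_
        refine (subsetProb_disjointOccur_le hp0 hp1 E (joined_monotone v w)
          (DisjointOccur.monotone _ _)).trans ?_
        refine mul_le_mul_of_nonneg_left ?_ (subsetProb_nonneg hp0 hp1 E _)
        exact subsetProb_disjointOccur_le hp0 hp1 E
          (forall_joined_monotone w x A) (forall_joined_monotone w x (A : Set ι)ᶜ)

lemma two_mul_clusterMoment_le {ι : Type*} [Fintype ι] [DecidableEq ι] [Nontrivial ι]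
    {p : ℝ} (hp0 : 0 ≤ p) (hp1 : p ≤ 1) (E : Finset (Sym2 V)) (v : V) :
    2 * clusterMoment p E (Fintype.card ι) v ≤
      ∑ A : Finset ι with A.Nonempty ∧ Aᶜ.Nonempty, ∑ w,
        (subsetProb p E fun F => Joined F v w) *
          (clusterMoment p E #A w * clusterMoment p E (Fintype.card ι - #A) w) := by
  simp only [clusterMoment_card (ι := ι), mul_sum, ← sum_subsetProb_mul]
  refine (sum_le_sum fun x _ => two_mul_subsetProb_joined_le hp0 hp1 E v x).trans_eq ?_
  rw [sum_comm]
  exact sum_congr rfl fun A _ => sum_comm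

/-- The number `(2n - 3)!!` of rooted binary trees with `n` labelled leaves, written through
Catalan numbers. -/
def labelledTreeCount (n : ℕ) : ℝ :=
  n.factorial * catalan (n - 1) / 2 ^ (n - 1)

lemma labelledTreeCount_nonneg (n : ℕ) : 0 ≤ labelledTreeCount n := by
  unfold labelledTreeCount
  positivity

lemma labelledTreeCount_succ (n : ℕ) :
    labelledTreeCount (n + 1) = (Nat.doubleFactorial (2 * (n + 1) - 3) : ℝ) := by
  have key : ∀ m : ℕ, m.factorial * m.centralBinom = 2 ^ m * Nat.doubleFactorial (2 * m - 1) := by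
    intro m
    induction m with
    | zero => simp
    | succ m ih =>
      have h : Nat.doubleFactorial (2 * (m + 1) - 1) =
          (2 * m + 1) * Nat.doubleFactorial (2 * m - 1) := by
        cases m with
        | zero => simp
        | succ m =>
          rw [show 2 * (m + 1 + 1) - 1 = (2 * (m + 1) - 1) + 2 by omega,
            Nat.doubleFactorial_add_two]
          congr 1
      rw [h, Nat.factorial_succ, mul_comm (m + 1), mul_assoc, Nat.succ_mul_centralBinom_succ]
      linear_combination 2 * (2 * m + 1) * ih
  have h : (n + 1).factorial * catalan n = 2 ^ n * Nat.doubleFactorial (2 * n - 1) := by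
    rw [← key, ← succ_mul_catalan_eq_centralBinom, Nat.factorial_succ]
    ring
  rw [labelledTreeCount, Nat.add_sub_cancel, div_eq_iff (by positivity),
    show 2 * (n + 1) - 3 = 2 * n - 1 by omega]
  rw [mul_comm (Nat.doubleFactorial _ : ℝ)]
  exact_mod_cast h

/-- A binary tree with labelled leaves splits at its root into two such trees. -/
lemma sum_labelledTreeCount_mul {ι : Type*} [Fintype ι] [DecidableEq ι] [Nontrivial ι] :
    ∑ A : Finset ι with A.Nonempty ∧ Aᶜ.Nonempty,
        labelledTreeCount #A * labelledTreeCount (Fintype.card ι - #A) =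
      2 * labelledTreeCount (Fintype.card ι) := by
  obtain ⟨n, hn⟩ : ∃ n, Fintype.card ι = n + 2 :=
    ⟨Fintype.card ι - 2, by have := Fintype.one_lt_card (α := ι); omega⟩
  rw [hn, sum_filter]
  set g : ℕ → ℝ := fun j =>
    if 0 < j ∧ j < n + 2 then labelledTreeCount j * labelledTreeCount (n + 2 - j) else 0 with hg
  have h1 : ∀ A : Finset ι, (if A.Nonempty ∧ Aᶜ.Nonempty then
      labelledTreeCount #A * labelledTreeCount (n + 2 - #A) else 0) = g #A := by
    intro A
    have : (A.Nonempty ∧ Aᶜ.Nonempty) ↔ (0 < #A ∧ #A < n + 2) := by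
      rw [← card_pos, ← card_pos, card_compl, hn]
      omega
    simp only [hg, this]
  rw [sum_congr rfl fun A _ => h1 A, ← powerset_univ, sum_powerset_apply_card, card_univ, hn,
    sum_range_succ, sum_range_succ']
  have h0 : g 0 = 0 := by simp [hg]
  have hlast : g (n + 2) = 0 := by simp [hg]
  rw [h0, hlast, smul_zero, smul_zero, add_zero, add_zero]
  have hterm : ∀ j ∈ range (n + 1), (n + 2).choose (j + 1) • g (j + 1) =
      ((n + 2).factorial / 2 ^ n : ℝ) * (catalan j * catalan (n - j) : ℕ) := by
    intro j hj
    obtain ⟨m, rfl⟩ := Nat.exists_eq_add_of_le (Nat.lt_succ_iff.mp (mem_range.mp hj))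
    have hc : ((j + m + 2).choose (j + 1) : ℝ) * (j + 1).factorial * (m + 1).factorial =
        (j + m + 2).factorial := by
      have := Nat.choose_mul_factorial_mul_factorial (n := j + m + 2) (k := j + 1) (by omega)
      rw [show j + m + 2 - (j + 1) = m + 1 by omega] at this
      exact_mod_cast this
    simp only [hg]
    rw [if_pos (by omega), show j + m + 2 - (j + 1) = m + 1 by omega, nsmul_eq_mul, ← hc]
    simp only [labelledTreeCount, Nat.add_sub_cancel, Nat.add_sub_cancel_left, pow_add]
    push_cast
    field_simp
  rw [sum_congr rfl hterm, ← mul_sum, ← Nat.cast_sum,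
    ← Nat.sum_antidiagonal_eq_sum_range_succ fun i j => catalan i * catalan j, ← catalan_succ']
  simp only [labelledTreeCount, show n + 2 - 1 = n + 1 by omega, pow_succ]
  field_simp

lemma clusterMoment_le {p χ : ℝ} (hp0 : 0 ≤ p) (hp1 : p ≤ 1) (E : Finset (Sym2 V))
    (hχ : ∀ v : V, clusterMoment p E 1 v = χ) (n : ℕ) (v : V) :
    clusterMoment p E (n + 1) v ≤ labelledTreeCount (n + 1) * χ ^ (2 * n + 1) := by
  have hχ0 : 0 ≤ χ := hχ v ▸ clusterMoment_nonneg hp0 hp1 E 1 v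
  induction n using Nat.strong_induction_on generalizing v with
  | _ n ih =>
    rcases Nat.eq_zero_or_pos n with rfl | hn
    · simp [hχ, labelledTreeCount]
    have : Nontrivial (Fin (n + 1)) := Fin.nontrivial_iff_two_le.mpr (by omega)
    have hrec := two_mul_clusterMoment_le (ι := Fin (n + 1)) hp0 hp1 E v
    have hsum := sum_labelledTreeCount_mul (ι := Fin (n + 1))
    rw [Fintype.card_fin] at hrec hsum
    have hbound : ∀ A : Finset (Fin (n + 1)), A.Nonempty ∧ Aᶜ.Nonempty →
        ∑ w, (subsetProb p E fun F => Joined F v w) *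
          (clusterMoment p E #A w * clusterMoment p E (n + 1 - #A) w) ≤
        labelledTreeCount #A * labelledTreeCount (n + 1 - #A) * χ ^ (2 * n + 1) := by
      rintro A ⟨hA, hA'⟩
      rw [← card_pos] at hA hA'
      rw [card_compl, Fintype.card_fin] at hA'
      obtain ⟨a, ha⟩ : ∃ a, #A = a + 1 := ⟨#A - 1, by omega⟩
      obtain ⟨b, hb⟩ : ∃ b, n + 1 - #A = b + 1 := ⟨n - #A, by omega⟩
      have hab : n = a + b + 1 := by omega
      rw [ha] at hb
      rw [ha, hb]
      calc _ ≤ ∑ w, (subsetProb p E fun F => Joined F v w) *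
            ((labelledTreeCount (a + 1) * χ ^ (2 * a + 1)) *
              (labelledTreeCount (b + 1) * χ ^ (2 * b + 1))) := by
            refine sum_le_sum fun w _ => mul_le_mul_of_nonneg_left ?_
              (subsetProb_nonneg hp0 hp1 E _)
            exact mul_le_mul (ih a (by omega) w) (ih b (by omega) w)
              (clusterMoment_nonneg hp0 hp1 E _ w)
              (mul_nonneg (labelledTreeCount_nonneg _) (pow_nonneg hχ0 _))
        _ = _ := by
            rw [← sum_mul, ← clusterMoment_one, hχ, hab]
            ring
    have := hrec.trans (sum_le_sum fun A hA => hbound A (mem_filter.mp hA).2)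
    rw [← sum_mul, hsum] at this
    linarith

end Moments

section Graph

variable {V : Type*} [Fintype V]

lemma joined_edgeFinset (H : SimpleGraph V) (a b : V) :
    Joined H.edgeFinset a b ↔ H.Reachable a b := by
  simp [Joined, SimpleGraph.reachable_iff_reflTransGen]

lemma clusterSize_edgeFinset (H : SimpleGraph V) (v : V) :
    clusterSize v H.edgeFinset = compSize H v := by
  simp [clusterSize, compSize, joined_edgeFinset, Nat.card_eq_fintype_card, Fintype.card_subtype]

lemma percExpect_compSize_pow (G : SimpleGraph V) (p : ℝ) (n : ℕ) (v : V) :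
    percExpect G p (fun H => (compSize H v : ℝ) ^ n) = clusterMoment p G.edgeFinset n v := by
  unfold percExpect clusterMoment subsetExpect
  refine sum_bij' (fun H _ => H.edgeFinset) (fun F _ => SimpleGraph.fromEdgeSet (F : Set (Sym2 V)))
    ?_ ?_ ?_ ?_ ?_
  · intro H hH
    simpa using hH
  · intro F hF
    have hF : (F : Set (Sym2 V)) ⊆ G.edgeSet := by
      intro e he
      simpa using mem_powerset.mp hF he
    simpa using (SimpleGraph.fromEdgeSet_mono hF).trans_eq (SimpleGraph.fromEdgeSet_edgeSet G)
  · intro H _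
    simp
  · intro F hF
    ext e
    have : e ∈ F → e ∈ G.edgeSet := fun he => by simpa using mem_powerset.mp hF he
    have h2 : e ∈ F → ¬ e.IsDiag := fun he => G.not_isDiag_of_mem_edgeSet (this he)
    simpa using h2
  · intro H _
    simp [clusterSize_edgeFinset, SimpleGraph.edgeFinset_card, Nat.card_eq_fintype_card]

lemma percExpect_compSize_iso (G : SimpleGraph V) (p : ℝ) (φ : G ≃g G) (n : ℕ) (v : V) :
    percExpect G p (fun H => (compSize H (φ v) : ℝ) ^ n) =
      percExpect G p (fun H => (compSize H v : ℝ) ^ n) := by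
  refine sum_equiv φ.toEquiv.symm.simpleGraph ?_ ?_
  · intro H
    simp only [mem_filter, mem_univ, true_and]
    constructor
    · intro h a b hab
      exact φ.map_adj_iff.mp (h hab)
    · intro h a b hab
      rw [← φ.symm.map_adj_iff]
      refine h ?_
      change H.Adj (φ (φ.symm a)) (φ (φ.symm b))
      simpa using hab
  · intro H _
    set H' := φ.toEquiv.symm.simpleGraph H
    let e : H' ≃g H := SimpleGraph.Iso.comap φ.toEquiv H
    have hcomp : compSize H' v = compSize H (φ v) :=
      Nat.card_congr (φ.toEquiv.subtypeEquiv fun _ => (SimpleGraph.Iso.reachable_iff (φ := e)).symm)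
    simp only [hcomp, Nat.card_congr e.mapEdgeSet]

end Graph

end Percolation

/-- The Aizenman–Newman tree-graph inequality: for percolation with parameter `p` on a
finite vertex-transitive graph `G`, every `k ≥ 1` and vertex `v`,
`E_p[|C(v)|^k] ≤ (2k−3)!! · (E_p|C(v)|)^{2k−1}`. -/
theorem tree_graph_inequality {V : Type*} [Fintype V] (G : SimpleGraph V)
    (htrans : ∀ v w : V, ∃ φ : G ≃g G, φ v = w)
    (p : ℝ) (hp0 : 0 ≤ p) (hp1 : p ≤ 1) (k : ℕ) (hk : 1 ≤ k) (v : V) :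
    percExpect G p (fun H => (compSize H v : ℝ) ^ k)
      ≤ (Nat.doubleFactorial (2 * k - 3) : ℝ) * (percExpect G p (fun H => (compSize H v : ℝ))) ^ (2 * k - 1) := by
  obtain ⟨n, rfl⟩ := Nat.exists_eq_add_of_le' hk
  have hχ : ∀ w, Percolation.clusterMoment p G.edgeFinset 1 w =
      percExpect G p (fun H => (compSize H v : ℝ)) := by
    intro w
    obtain ⟨φ, rfl⟩ := htrans v w
    rw [← Percolation.percExpect_compSize_pow, Percolation.percExpect_compSize_iso]
    simp only [pow_one]
  rw [Percolation.percExpect_compSize_pow, ← Percolation.labelledTreeCount_succ]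
  exact Percolation.clusterMoment_le hp0 hp1 G.edgeFinset hχ n v
end
end
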